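/- arXiv:2501.14064 — 2 statements merged into one kernel-verified Lean document; each statement's English description precedes it below -/
import Mathlib

section
/- If M1 and M2 are independent random variables taking values in finite sets and Y is any random variable taking values in a finite set on the same probability space, then I(M1,M2 ; Y) ≤ I(M1 ; Y | M2) + I(M2 ; Y | M1). -/
open MeasureTheory

namespace SF

variable {Ω : Type*} [MeasurableSpace Ω]

/-- The probability that a random variable `X` takes the value `a`. -/
noncomputable def pr (μ : Measure Ω) {A : Type*} (X : Ω → A) (a : A) : ℝ :=
  (μ (X ⁻¹' {a})).toReal

/-- Shannon entropy (natural logarithm) of a finite-valued random variable. -/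
noncomputable def ent (μ : Measure Ω) {A : Type*} [Fintype A] (X : Ω → A) : ℝ :=
  ∑ a, Real.negMulLog (pr μ X a)

/-- Conditional entropy `H(X | Y)`. -/
noncomputable def condEnt (μ : Measure Ω) {A B : Type*} [Fintype A] [Fintype B]
    (X : Ω → A) (Y : Ω → B) : ℝ :=
  ent μ (fun ω => (X ω, Y ω)) - ent μ Y

/-- Mutual information `I(X ; Y)`. -/
noncomputable def mi (μ : Measure Ω) {A B : Type*} [Fintype A] [Fintype B]
    (X : Ω → A) (Y : Ω → B) : ℝ :=
  ent μ X + ent μ Y - ent μ (fun ω => (X ω, Y ω))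

/-- Conditional mutual information `I(X ; Y | Z)`. -/
noncomputable def cmi (μ : Measure Ω) {A B C : Type*} [Fintype A] [Fintype B] [Fintype C]
    (X : Ω → A) (Y : Ω → B) (Z : Ω → C) : ℝ :=
  ent μ (fun ω => (X ω, Z ω)) + ent μ (fun ω => (Y ω, Z ω))
    - ent μ (fun ω => (X ω, Y ω, Z ω)) - ent μ Z

end SF

open SF MeasureTheory

namespace SF

variable {Ω : Type*} [MeasurableSpace Ω] {A B C D : Type*}

lemma pr_nonneg (μ : Measure Ω) (X : Ω → A) (a : A) : 0 ≤ pr μ X a :=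
  ENNReal.toReal_nonneg

/-- If `T` refines `X`, the fiber of `X` over `a` being indexed by the values of `Y`, then the
probability that `X = a` is the sum of the probabilities of the corresponding values of `T`. -/
lemma pr_eq_sum [Fintype B] (μ : Measure Ω) [IsFiniteMeasure μ] (X : Ω → A) (a : A)
    (Y : Ω → B) (T : Ω → D) (d : B → D) (hT : ∀ t, MeasurableSet (T ⁻¹' {t}))
    (h : ∀ ω b, T ω = d b ↔ X ω = a ∧ Y ω = b) :
    pr μ X a = ∑ b, pr μ T (d b) := by
  have hunion : X ⁻¹' {a} = ⋃ b, T ⁻¹' {d b} := by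
    ext ω
    simp [h]
  have hdisj : Pairwise (Function.onFun Disjoint fun b => T ⁻¹' {d b}) := by
    intro b b' hne
    refine Set.disjoint_left.mpr fun ω hb hb' => hne ?_
    exact ((h ω b).1 hb).2.symm.trans ((h ω b').1 hb').2
  unfold pr
  rw [hunion, measure_iUnion hdisj fun b => hT _, tsum_fintype,
    ENNReal.toReal_sum fun b _ => measure_ne_top μ _]

lemma sum_pr_eq_one [Fintype B] (μ : Measure Ω) [IsProbabilityMeasure μ] (X : Ω → B)
    (hX : ∀ b, MeasurableSet (X ⁻¹' {b})) : ∑ b, pr μ X b = 1 := by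
  rw [← pr_eq_sum μ (fun _ => ()) () X X (fun b => b) hX (by simp)]
  simp [pr]

/-- Entropy is invariant under relabelling of values. -/
lemma ent_eq_of_equiv [Fintype A] [Fintype B] (μ : Measure Ω) (X : Ω → A) (Y : Ω → B)
    (e : A ≃ B) (h : ∀ ω, e (X ω) = Y ω) : ent μ Y = ent μ X := by
  unfold ent
  rw [← e.sum_comp]
  refine Finset.sum_congr rfl fun a _ => ?_
  simp [pr, Set.preimage, ← h]

/-- Entropy is additive over independent random variables. -/
lemma ent_prod_of_pr_eq_mul [Fintype A] [Fintype B] (μ : Measure Ω) (X : Ω → A) (Y : Ω → B)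
    (hX : ∑ a, pr μ X a = 1) (hY : ∑ b, pr μ Y b = 1)
    (h : ∀ a b, pr μ (fun ω => (X ω, Y ω)) (a, b) = pr μ X a * pr μ Y b) :
    ent μ (fun ω => (X ω, Y ω)) = ent μ X + ent μ Y := by
  simp only [ent, Fintype.sum_prod_type, h, Real.negMulLog_mul, Finset.sum_add_distrib,
    ← Finset.mul_sum, ← Finset.sum_mul, hX, hY, one_mul]

/-- The pointwise bound behind the nonnegativity of conditional mutual information. -/
lemma sub_le_mul_log {p q r s : ℝ} (hp : 0 ≤ p) (hq : p ≤ q) (hr : p ≤ r) (hs : p ≤ s) :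
    p - q * r / s ≤ p * (Real.log p + Real.log s - Real.log q - Real.log r) := by
  rcases hp.eq_or_lt with rfl | hp
  · have : 0 ≤ q * r / s := by positivity
    simpa using this
  have hq' := hp.trans_le hq
  have hr' := hp.trans_le hr
  have hs' := hp.trans_le hs
  have hlog := Real.log_le_sub_one_of_pos (show 0 < q * r / (p * s) by positivity)
  rw [Real.log_div (by positivity) (by positivity), Real.log_mul hq'.ne' hr'.ne',
    Real.log_mul hp.ne' hs'.ne'] at hlog
  have hmul := mul_le_mul_of_nonneg_left hlog hp.le
  have heq : p * (q * r / (p * s)) = q * r / s := by field_simp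
  linarith

/-- Conditional mutual information is nonnegative. -/
lemma cmi_nonneg [Fintype A] [Fintype B] [Fintype C] (μ : Measure Ω) [IsFiniteMeasure μ]
    (X : Ω → A) (Y : Ω → B) (Z : Ω → C)
    (hT : ∀ t, MeasurableSet ((fun ω => (X ω, Y ω, Z ω)) ⁻¹' {t})) :
    0 ≤ cmi μ X Y Z := by
  set p := fun a b c => pr μ (fun ω => (X ω, Y ω, Z ω)) (a, b, c) with hp
  have hp0 : ∀ a b c, 0 ≤ p a b c := fun _ _ _ => pr_nonneg _ _ _
  set q := fun a c => ∑ b, p a b c with hq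
  set r := fun b c => ∑ a, p a b c with hr
  set s := fun c => ∑ a, ∑ b, p a b c with hs
  have hXZ : ∀ a c, pr μ (fun ω => (X ω, Z ω)) (a, c) = q a c := fun a c =>
    pr_eq_sum μ _ _ Y _ (fun b => (a, b, c)) hT (by simp; tauto)
  have hYZ : ∀ b c, pr μ (fun ω => (Y ω, Z ω)) (b, c) = r b c := fun b c =>
    pr_eq_sum μ _ _ X _ (fun a => (a, b, c)) hT (by simp; tauto)
  have hZ : ∀ c, pr μ Z c = s c := fun c => by
    rw [pr_eq_sum μ Z c (fun ω => (X ω, Y ω)) _ (fun t => (t.1, t.2, c)) hT (by simp; tauto),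
      Fintype.sum_prod_type]
  have hpq : ∀ a b c, p a b c ≤ q a c := fun a b c =>
    Finset.single_le_sum (f := fun b => p a b c) (fun _ _ => hp0 _ _ _) (Finset.mem_univ b)
  have hpr : ∀ a b c, p a b c ≤ r b c := fun a b c =>
    Finset.single_le_sum (f := fun a => p a b c) (fun _ _ => hp0 _ _ _) (Finset.mem_univ a)
  have hq0 : ∀ a c, 0 ≤ q a c := fun a c => Finset.sum_nonneg fun _ _ => hp0 _ _ _
  have hqs : ∀ a c, q a c ≤ s c := fun a c =>
    Finset.single_le_sum (f := fun a => q a c) (fun _ _ => hq0 _ _) (Finset.mem_univ a)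
  have hrs : ∀ c, ∑ b, r b c = s c := fun c => Finset.sum_comm
  have hcmi : cmi μ X Y Z = ∑ c, ∑ a, ∑ b, p a b c *
      (Real.log (p a b c) + Real.log (s c) - Real.log (q a c) - Real.log (r b c)) := by
    have hentXZ : ent μ (fun ω => (X ω, Z ω))
        = -∑ c, ∑ a, ∑ b, p a b c * Real.log (q a c) := by
      simp only [ent, Fintype.sum_prod_type, hXZ, Real.negMulLog, ← Finset.sum_mul, neg_mul,
        Finset.sum_neg_distrib]
      rw [Finset.sum_comm]
    have hentYZ : ent μ (fun ω => (Y ω, Z ω))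
        = -∑ c, ∑ a, ∑ b, p a b c * Real.log (r b c) := by
      simp only [ent, Fintype.sum_prod_type, hYZ, Real.negMulLog, neg_mul,
        Finset.sum_neg_distrib]
      rw [Finset.sum_comm]
      congr 1
      refine Finset.sum_congr rfl fun c _ => ?_
      rw [Finset.sum_comm]
      simp only [← Finset.sum_mul, hr]
    have hentZ : ent μ Z = -∑ c, ∑ a, ∑ b, p a b c * Real.log (s c) := by
      simp only [ent, hZ, Real.negMulLog, ← Finset.sum_mul, neg_mul, Finset.sum_neg_distrib, hs]
    have hentXYZ : ent μ (fun ω => (X ω, Y ω, Z ω))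
        = -∑ c, ∑ a, ∑ b, p a b c * Real.log (p a b c) := by
      simp only [ent, Fintype.sum_prod_type, Real.negMulLog, neg_mul, Finset.sum_neg_distrib, hp]
      rw [Finset.sum_comm (s := (Finset.univ : Finset C))]
      congr 1
      exact Finset.sum_congr rfl fun a _ => Finset.sum_comm
    rw [cmi, hentXZ, hentYZ, hentZ, hentXYZ]
    simp only [mul_sub, mul_add, Finset.sum_sub_distrib, Finset.sum_add_distrib]
    ring
  rw [hcmi]
  refine Finset.sum_nonneg fun c _ => ?_
  calc (0 : ℝ) = ∑ a, ∑ b, (p a b c - q a c * r b c / s c) := by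
        simp only [Finset.sum_sub_distrib, ← Finset.sum_div, ← Finset.mul_sum, hrs,
          ← Finset.sum_mul]
        change 0 = s c - s c * s c / s c
        rw [mul_self_div_self, sub_self]
    _ ≤ _ := Finset.sum_le_sum fun a _ => Finset.sum_le_sum fun b _ =>
        sub_le_mul_log (hp0 a b c) (hpq a b c) (hpr a b c) ((hpq a b c).trans (hqs a c))

end SF

/-- If `M1` and `M2` are independent random variables taking values in finite
sets and `Y` is any finite-valued random variable on the same probability space, then
`I(M1,M2 ; Y) ≤ I(M1 ; Y | M2) + I(M2 ; Y | M1)`. -/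
theorem statement1 {Ω : Type*} [MeasurableSpace Ω] (μ : Measure Ω) [IsProbabilityMeasure μ]
    {A1 A2 AY : Type*} [Fintype A1] [Fintype A2] [Fintype AY]
    (M1 : Ω → A1) (M2 : Ω → A2) (Y : Ω → AY)
    (hmeas : ∀ (a : A1) (b : A2) (c : AY),
      MeasurableSet ((fun ω => (M1 ω, M2 ω, Y ω)) ⁻¹' {(a, b, c)}))
    (hindep : ∀ (a : A1) (b : A2),
      pr μ (fun ω => (M1 ω, M2 ω)) (a, b) = pr μ M1 a * pr μ M2 b) :
    mi μ (fun ω => (M1 ω, M2 ω)) Y ≤ cmi μ M1 Y M2 + cmi μ M2 Y M1 := by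
  have hT : ∀ t, MeasurableSet ((fun ω => (M1 ω, M2 ω, Y ω)) ⁻¹' {t}) := by
    rintro ⟨a, b, c⟩
    exact hmeas a b c
  have hsum1 : ∑ a, pr μ M1 a = 1 := by
    refine sum_pr_eq_one μ M1 fun a => ?_
    have : M1 ⁻¹' {a} = ⋃ t : A2 × AY, (fun ω => (M1 ω, M2 ω, Y ω)) ⁻¹' {(a, t)} := by
      ext ω
      simp
    rw [this]
    exact MeasurableSet.iUnion fun t => hT _
  have hsum2 : ∑ b, pr μ M2 b = 1 := by
    refine sum_pr_eq_one μ M2 fun b => ?_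
    have : M2 ⁻¹' {b} =
        ⋃ t : A1 × AY, (fun ω => (M1 ω, M2 ω, Y ω)) ⁻¹' {(t.1, b, t.2)} := by
      ext ω
      simp
    rw [this]
    exact MeasurableSet.iUnion fun t => hT _
  have hind := ent_prod_of_pr_eq_mul μ M1 M2 hsum1 hsum2 hindep
  have hcmi := cmi_nonneg μ M1 M2 Y hT
  have h21 : ent μ (fun ω => (M2 ω, M1 ω)) = ent μ (fun ω => (M1 ω, M2 ω)) :=
    ent_eq_of_equiv μ _ _ (Equiv.prodComm A1 A2) fun _ => rfl
  have hY1 : ent μ (fun ω => (Y ω, M1 ω)) = ent μ (fun ω => (M1 ω, Y ω)) :=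
    ent_eq_of_equiv μ _ _ (Equiv.prodComm A1 AY) fun _ => rfl
  have hY2 : ent μ (fun ω => (Y ω, M2 ω)) = ent μ (fun ω => (M2 ω, Y ω)) :=
    ent_eq_of_equiv μ _ _ (Equiv.prodComm A2 AY) fun _ => rfl
  have h12Y : ent μ (fun ω => ((M1 ω, M2 ω), Y ω)) = ent μ (fun ω => (M1 ω, M2 ω, Y ω)) :=
    ent_eq_of_equiv μ _ _ (Equiv.prodAssoc A1 A2 AY).symm fun _ => rfl
  have h1Y2 : ent μ (fun ω => (M1 ω, Y ω, M2 ω)) = ent μ (fun ω => (M1 ω, M2 ω, Y ω)) :=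
    ent_eq_of_equiv μ _ _ ((Equiv.refl A1).prodCongr (Equiv.prodComm A2 AY)) fun _ => rfl
  have h2Y1 : ent μ (fun ω => (M2 ω, Y ω, M1 ω)) = ent μ (fun ω => (M1 ω, M2 ω, Y ω)) :=
    ent_eq_of_equiv μ _ _
      ((Equiv.prodComm A1 (A2 × AY)).trans (Equiv.prodAssoc A2 AY A1)) fun _ => rfl
  unfold cmi at hcmi ⊢
  unfold mi
  linarith
end

section
/- Fix an integer α ≥ 1 and let m = α·2^α. Define y : {0,…,m−1} × {0,…,m−1} → ({0,…,m−1} × {0,…,m−1}) ⊔ (ℤ/mℤ) by y(x1,x2) = (x1,x2) (in the left summand) if ⌊x1/α⌋ = ⌊x2/α⌋, and y(x1,x2) = (x1 + x2) mod m (in the right summand) otherwise. Then for every fixed x2 the map x1 ↦ y(x1,x2) is injective, and for every fixed x1 the map x2 ↦ y(x1,x2) is injective. Consequently, for every joint distribution of (X1,X2) on {0,…,m−1}² with Y = y(X1,X2), H(X1 | Y, X2) = 0 and H(X2 | Y, X1) = 0. -/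
open MeasureTheory

open SF MeasureTheory

namespace SF

variable {Ω : Type*} [MeasurableSpace Ω]

/-- Entropy is invariant under injective relabelling of the values. -/
theorem ent_comp_of_injective (μ : Measure Ω) {A B : Type*} [Fintype A] [Fintype B]
    (Z : Ω → A) {f : A → B} (hf : Function.Injective f) :
    ent μ (fun ω => f (Z ω)) = ent μ Z := by
  unfold ent
  refine (Fintype.sum_of_injective f hf _ _ (fun b hb => ?_) (fun a => ?_)).symm
  · have h : (fun ω => f (Z ω)) ⁻¹' {b} = ∅ := by
      ext ω
      simpa using fun h => hb ⟨Z ω, h⟩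
    simp [pr, h]
  · have h : (fun ω => f (Z ω)) ⁻¹' {f a} = Z ⁻¹' {a} := by
      ext ω
      simp [hf.eq_iff]
    simp [pr, h]

/-- The conditional entropy of a variable given one that determines it vanishes. -/
theorem condEnt_eq_zero_of_eq_comp (μ : Measure Ω) {A B : Type*} [Fintype A] [Fintype B]
    {X : Ω → A} {Y : Ω → B} (g : B → A) (h : ∀ ω, g (Y ω) = X ω) : condEnt μ X Y = 0 := by
  have hinj : Function.Injective (fun b => (g b, b)) := fun _ _ h => congrArg Prod.snd h
  rw [condEnt, sub_eq_zero, ← ent_comp_of_injective μ Y hinj]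
  simp only [h]

end SF

theorem Fin.eq_of_natCast_zmod_eq {m : ℕ} {a b : Fin m} (h : ((a : ℕ) : ZMod m) = (b : ℕ)) :
    a = b := by
  rw [ZMod.natCast_eq_natCast_iff', Nat.mod_eq_of_lt a.2, Nat.mod_eq_of_lt b.2] at h
  exact Fin.ext h

/-- Fix `α ≥ 1` and `m = α·2^α`. Define
`y(x1,x2) = (x1,x2)` (left summand) if `⌊x1/α⌋ = ⌊x2/α⌋`, and
`y(x1,x2) = (x1+x2) mod m` (right summand) otherwise. Then `y` is injective in each
argument separately, and consequently for every joint distribution of `(X1,X2)` on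
`{0,…,m−1}²` with `Y = y(X1,X2)`, `H(X1 | Y, X2) = 0` and `H(X2 | Y, X1) = 0`. -/
theorem statement6 (α m : ℕ) (hα : 1 ≤ α) (hm : m = α * 2 ^ α) [NeZero m]
    (y : Fin m × Fin m → (Fin m × Fin m) ⊕ ZMod m)
    (hy : ∀ x1 x2 : Fin m,
      y (x1, x2) = if (x1 : ℕ) / α = (x2 : ℕ) / α then Sum.inl (x1, x2)
        else Sum.inr ((((x1 : ℕ) + (x2 : ℕ) : ℕ)) : ZMod m)) :
    (∀ x2 : Fin m, Function.Injective (fun x1 => y (x1, x2)))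
    ∧ (∀ x1 : Fin m, Function.Injective (fun x2 => y (x1, x2)))
    ∧ ∀ (Ω : Type) [MeasurableSpace Ω] (μ : Measure Ω) [IsProbabilityMeasure μ]
        (X1 X2 : Ω → Fin m),
        (∀ a b : Fin m, MeasurableSet ((fun ω => (X1 ω, X2 ω)) ⁻¹' {(a, b)})) →
        condEnt μ X1 (fun ω => (y (X1 ω, X2 ω), X2 ω)) = 0
        ∧ condEnt μ X2 (fun ω => (y (X1 ω, X2 ω), X1 ω)) = 0 := by
  have inj₁ : ∀ x2 : Fin m, Function.Injective (fun x1 => y (x1, x2)) := by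
    intro c a b h
    simp only [hy] at h
    split_ifs at h
    · exact congrArg Prod.fst (Sum.inl.inj h)
    · push_cast at h
      exact Fin.eq_of_natCast_zmod_eq (add_right_cancel (Sum.inr.inj h))
  have inj₂ : ∀ x1 : Fin m, Function.Injective (fun x2 => y (x1, x2)) := by
    intro c a b h
    simp only [hy] at h
    split_ifs at h
    · exact congrArg Prod.snd (Sum.inl.inj h)
    · push_cast at h
      exact Fin.eq_of_natCast_zmod_eq (add_left_cancel (Sum.inr.inj h))
  refine ⟨inj₁, inj₂, fun Ω _ μ _ X1 X2 _ => ⟨?_, ?_⟩⟩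
  · exact condEnt_eq_zero_of_eq_comp μ
      (fun p => Function.invFun (fun x1 => y (x1, p.2)) p.1)
      (fun ω => Function.leftInverse_invFun (inj₁ (X2 ω)) (X1 ω))
  · exact condEnt_eq_zero_of_eq_comp μ
      (fun p => Function.invFun (fun x2 => y (p.2, x2)) p.1)
      (fun ω => Function.leftInverse_invFun (inj₂ (X1 ω)) (X2 ω))
end
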